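/- For every partition λ with at most n parts, V*_λ equals the K-linear span of the interpolation nonsymmetric Macdonald polynomials {E*_μ : μ ∈ S_n(λ)}. -/

import Mathlib

open MvPolynomial

noncomputable section
open scoped Classical

/-- The field `K = ℚ(q,t)`. -/
abbrev K : Type := FractionRing (MvPolynomial (Fin 2) ℚ)

/-- The indeterminate `q` as an element of `K`. -/
def qq : K := algebraMap (MvPolynomial (Fin 2) ℚ) K (X 0)

/-- The indeterminate `t` as an element of `K`. -/
def tt : K := algebraMap (MvPolynomial (Fin 2) ℚ) K (X 1)

/-- The size `|ν|` of a composition. -/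
def csize {n : ℕ} (ν : Fin n → ℕ) : ℕ := ∑ i, ν i

/-- `k_i(ν) = #{j < i : ν_j > ν_i} + #{j > i : ν_j ≥ ν_i}`. -/
def kstat {n : ℕ} (ν : Fin n → ℕ) (i : Fin n) : ℕ :=
  Set.ncard {j : Fin n | j < i ∧ ν i < ν j} + Set.ncard {j : Fin n | i < j ∧ ν i ≤ ν j}

/-- The evaluation point `ν̃ = (q^{ν_i} t^{-k_i(ν)})_i`. -/
def evalPt {n : ℕ} (ν : Fin n → ℕ) : Fin n → K :=
  fun i => qq ^ ν i * tt ^ (-(kstat ν i : ℤ))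

/-- Weakly decreasing composition. -/
def IsPartition {n : ℕ} (l : Fin n → ℕ) : Prop := ∀ i j : Fin n, i ≤ j → l j ≤ l i

/-- The action `σ·μ := μ ∘ σ⁻¹`. -/
def permAct {n : ℕ} (σ : Equiv.Perm (Fin n)) (μ : Fin n → ℕ) : Fin n → ℕ := μ ∘ ⇑σ.symm

/-- `S_n(λ)`: the rearrangements of `λ`. -/
def Sn {n : ℕ} (l : Fin n → ℕ) : Set (Fin n → ℕ) :=
  {μ | ∃ σ : Equiv.Perm (Fin n), permAct σ l = μ}

/-- The rearrangements of `λ` as a `Finset`. -/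
def SnFinset {n : ℕ} (l : Fin n → ℕ) : Finset (Fin n → ℕ) :=
  Finset.image (fun σ : Equiv.Perm (Fin n) => permAct σ l) Finset.univ

/-- The exponent `Finsupp` of the monomial `x^μ`. -/
def expOf {n : ℕ} (μ : Fin n → ℕ) : Fin n →₀ ℕ := Finsupp.equivFunOnFinite.symm μ

/-- Characterization of the interpolation nonsymmetric Macdonald polynomial `E*_μ`. -/
def IsEstar {n : ℕ} (μ : Fin n → ℕ) (f : MvPolynomial (Fin n) K) : Prop :=
  f.totalDegree ≤ csize μ ∧ coeff (expOf μ) f = 1 ∧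
    ∀ ν : Fin n → ℕ, csize ν ≤ csize μ → ν ≠ μ → eval (evalPt ν) f = 0

/-- The interpolation nonsymmetric Macdonald polynomial `E*_μ` (unique by Knop–Sahi). -/
def Estar {n : ℕ} (μ : Fin n → ℕ) : MvPolynomial (Fin n) K :=
  if h : ∃ f, IsEstar μ f then h.choose else 0

/-- Characterization of the interpolation (symmetric) Macdonald polynomial `P*_λ`. -/
def IsPstar {n : ℕ} (l : Fin n → ℕ) (f : MvPolynomial (Fin n) K) : Prop :=
  f.IsSymmetric ∧ f.totalDegree ≤ csize l ∧ coeff (expOf l) f = 1 ∧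
    ∀ ν : Fin n → ℕ, IsPartition ν → csize ν ≤ csize l → ν ≠ l → eval (evalPt ν) f = 0

/-- The interpolation Macdonald polynomial `P*_λ`. -/
def Pstar {n : ℕ} (l : Fin n → ℕ) : MvPolynomial (Fin n) K :=
  if h : ∃ f, IsPstar l f then h.choose else 0

/-- The space `V*_λ`. -/
def Vstar {n : ℕ} (l : Fin n → ℕ) : Submodule K (MvPolynomial (Fin n) K) :=
  (restrictTotalDegree (Fin n) K (csize l)) ⊓
    ⨅ (ν : Fin n → ℕ) (_ : csize ν ≤ csize l ∧ ν ∉ Sn l),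
      LinearMap.ker (aeval (R := K) (evalPt ν)).toLinearMap

/-- Exchange of the variables `x_i` and `x_j` in a polynomial. -/
def swapVars {n : ℕ} (i j : Fin n) (f : MvPolynomial (Fin n) K) : MvPolynomial (Fin n) K :=
  rename (Equiv.swap i j) f

/-- Exact division of polynomials: the unique `g` with `a = b * g` when it exists. -/
def exactDiv {n : ℕ} (a b : MvPolynomial (Fin n) K) : MvPolynomial (Fin n) K :=
  if h : ∃ g, a = b * g then h.choose else 0

/-- The Hecke operator
`T f = t f − ((t x_i − x_j)/(x_i − x_j))·(f − s_i f)` (where `j = i+1`). -/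
def hecke {n : ℕ} (i j : Fin n) (f : MvPolynomial (Fin n) K) : MvPolynomial (Fin n) K :=
  C tt * f - (C tt * X i - X j) * exactDiv (f - swapVars i j f) (X i - X j)

/-- The Coxeter length of a permutation (number of inversions). -/
def permLength {n : ℕ} (σ : Equiv.Perm (Fin n)) : ℕ :=
  Set.ncard {p : Fin n × Fin n | p.1 < p.2 ∧ σ p.2 < σ p.1}

/-- The adjacent transposition `s_i = (i, i+1)` (0-indexed). -/
def adjSwap {n : ℕ} (i : {i : ℕ // i + 1 < n}) : Equiv.Perm (Fin n) :=
  Equiv.swap ⟨i.1, Nat.lt_of_succ_lt i.2⟩ ⟨i.1 + 1, i.2⟩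

/-- The Hecke operator `T_i` for an adjacent transposition index. -/
def heckeAt {n : ℕ} (i : {i : ℕ // i + 1 < n}) :
    MvPolynomial (Fin n) K → MvPolynomial (Fin n) K :=
  hecke ⟨i.1, Nat.lt_of_succ_lt i.2⟩ ⟨i.1 + 1, i.2⟩

/-- `T_{i_1} ⋯ T_{i_ℓ} f` for a word `w = [i_1, …, i_ℓ]`. -/
def Tword {n : ℕ} (w : List {i : ℕ // i + 1 < n}) (f : MvPolynomial (Fin n) K) :
    MvPolynomial (Fin n) K :=
  w.foldr heckeAt f

/-- `w` is a reduced word for `σ`. -/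
def IsReducedWordOf {n : ℕ} (w : List {i : ℕ // i + 1 < n}) (σ : Equiv.Perm (Fin n)) : Prop :=
  (w.map adjSwap).prod = σ ∧ w.length = permLength σ

/-- `T_σ`, computed from a reduced word of `σ` (independent of the choice, by the
Hecke algebra relations). -/
def Tsigma {n : ℕ} (σ : Equiv.Perm (Fin n)) :
    MvPolynomial (Fin n) K → MvPolynomial (Fin n) K :=
  if h : ∃ w, IsReducedWordOf w σ then Tword h.choose else id

/-- `σ_μ`: the (unique) shortest permutation with `σ·l = μ`. -/
def sigmaMin {n : ℕ} (l μ : Fin n → ℕ) : Equiv.Perm (Fin n) :=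
  if h : ∃ σ, permAct σ l = μ ∧ ∀ τ, permAct τ l = μ → permLength σ ≤ permLength τ then
    h.choose else 1

/-- The weakly decreasing rearrangement of a composition. -/
def sortDesc {n : ℕ} (μ : Fin n → ℕ) : Fin n → ℕ :=
  if h : ∃ l, IsPartition l ∧ μ ∈ Sn l then h.choose else μ

/-- The interpolation ASEP polynomial `f*_μ = T_{σ_μ} E*_λ`, where `λ` is the weakly
decreasing rearrangement of `μ`. -/
def fstar {n : ℕ} (μ : Fin n → ℕ) : MvPolynomial (Fin n) K :=
  Tsigma (sigmaMin (sortDesc μ) μ) (Estar (sortDesc μ))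

/-- The composition with entries `i` and `j` exchanged. -/
def swapEntries {n : ℕ} (i j : Fin n) (μ : Fin n → ℕ) : Fin n → ℕ := μ ∘ ⇑(Equiv.swap i j)

/-- Compositions of size at most `d`. -/
abbrev CompLe (n d : ℕ) : Type := {η : Fin n → ℕ // csize η ≤ d}

theorem le_csize {n : ℕ} (ν : Fin n → ℕ) (i : Fin n) : ν i ≤ csize ν :=
  Finset.single_le_sum (f := ν) (fun _ _ => Nat.zero_le _) (Finset.mem_univ i)

instance compLeFintype (n d : ℕ) : Fintype (CompLe n d) :=
  Fintype.ofInjective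
    (fun η : CompLe n d => fun i : Fin n =>
      (⟨η.1 i, Nat.lt_succ_of_le ((le_csize η.1 i).trans η.2)⟩ : Fin (d + 1)))
    (by
      intro a b h
      apply Subtype.ext
      funext i
      have := congrFun h i
      simpa using this)

/-- The polynomial with given coefficients. -/
def polyOf {F : Type} [Field F] {n d : ℕ} (c : CompLe n d → F) : MvPolynomial (Fin n) F :=
  ∑ η : CompLe n d, monomial (expOf η.1) (c η)

theorem expOf_injective {n : ℕ} : Function.Injective (expOf (n := n)) :=
  Finsupp.equivFunOnFinite.symm.injective

theorem expOf_coe {n : ℕ} (t : Fin n →₀ ℕ) : expOf (fun i => t i) = t := by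
  ext i; rfl

theorem degree_expOf {n : ℕ} (μ : Fin n → ℕ) : (expOf μ).degree = csize μ := by
  rw [Finsupp.degree_eq_sum]; rfl

theorem degree_eq_csize {n : ℕ} (t : Fin n →₀ ℕ) : t.degree = csize (fun i => t i) := by
  rw [Finsupp.degree_eq_sum]; rfl

theorem coeff_polyOf {F : Type} [Field F] {n d : ℕ} (c : CompLe n d → F) (η : CompLe n d) :
    coeff (expOf η.1) (polyOf c) = c η := by
  unfold polyOf
  rw [coeff_sum, Finset.sum_eq_single η]
  · simp
  · intro b _ hb
    rw [coeff_monomial, if_neg]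
    intro h
    exact hb (Subtype.ext (expOf_injective h))
  · intro h; exact absurd (Finset.mem_univ _) h

theorem eval_polyOf {F : Type} [Field F] {n d : ℕ} (c : CompLe n d → F) (x : Fin n → F) :
    eval x (polyOf c) = ∑ η : CompLe n d, (∏ i, x i ^ η.1 i) * c η := by
  unfold polyOf
  rw [map_sum]
  refine Finset.sum_congr rfl fun η _ => ?_
  rw [eval_monomial, mul_comm, Finsupp.prod_fintype _ _ (fun i => pow_zero _)]
  rfl

theorem totalDegree_polyOf {F : Type} [Field F] {n d : ℕ} (c : CompLe n d → F) :
    (polyOf c).totalDegree ≤ d := by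
  unfold polyOf
  refine totalDegree_finsetSum_le fun η _ => ?_
  refine (totalDegree_monomial_le _ _).trans ?_
  have := degree_expOf η.1
  rw [Finsupp.degree] at this
  exact this.le.trans η.2

theorem polyOf_coeff {F : Type} [Field F] {n d : ℕ} (f : MvPolynomial (Fin n) F)
    (hf : f.totalDegree ≤ d) :
    polyOf (fun η : CompLe n d => coeff (expOf η.1) f) = f := by
  ext m
  by_cases hm : csize (fun i => m i) ≤ d
  · have := coeff_polyOf (fun η : CompLe n d => coeff (expOf η.1) f) ⟨fun i => m i, hm⟩
    simpa only [expOf_coe] using this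
  · push Not at hm
    have h1 : m.degree = ∑ i ∈ m.support, m i := rfl
    rw [← degree_eq_csize, h1] at hm
    rw [coeff_eq_zero_of_totalDegree_lt (lt_of_le_of_lt (totalDegree_polyOf _) hm),
      coeff_eq_zero_of_totalDegree_lt (lt_of_le_of_lt hf hm)]

/-- Unisolvence of grid points. -/
theorem grid_unisolvent {F : Type} [Field F] {n d : ℕ} (a : ℕ → F)
    (ha : Function.Injective a) (Z : Set (Fin n → ℕ)) (hZ : ∀ z ∈ Z, csize z = d)
    (f : MvPolynomial (Fin n) F) (hf : f.totalDegree ≤ d)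
    (h0 : ∀ z ∈ Z, coeff (expOf z) f = 0)
    (h1 : ∀ ν : Fin n → ℕ, csize ν ≤ d → ν ∉ Z → eval (fun i => a (ν i)) f = 0) : f = 0 := by
  by_contra hne
  have hs : f.support.Nonempty := support_nonempty.mpr hne
  obtain ⟨t, ht, htd⟩ := Finset.exists_mem_eq_sup f.support hs (fun m => m.degree)
  have htd' : f.totalDegree = t.degree := htd
  obtain ⟨s, hs1, hs2⟩ := combinatorial_nullstellensatz_exists_eval_nonzero f t
    (mem_support_iff.mp ht) htd' (fun i => (Finset.range (t i + 1)).image a)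
    (fun i => by rw [Finset.card_image_of_injective _ ha]; simp)
  have hs3 : ∀ i, ∃ k, k ≤ t i ∧ a k = s i := by
    intro i
    obtain ⟨k, hk, hk'⟩ := Finset.mem_image.mp (hs1 i)
    exact ⟨k, Nat.lt_succ_iff.mp (Finset.mem_range.mp hk), hk'⟩
  choose ν hν hνs using hs3
  have hse : (fun i => a (ν i)) = s := funext hνs
  have htc := degree_eq_csize t
  have hle : csize ν ≤ csize (fun i => t i) := Finset.sum_le_sum fun i _ => hν i
  have hνd : csize ν ≤ d := by omega
  have hνZ : ν ∈ Z := by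
    by_contra hn
    exact hs2 (hse ▸ h1 ν hνd hn)
  have hνe := hZ ν hνZ
  have hsum : ∑ i, ν i = ∑ i, t i := by
    change csize ν = csize (fun i => t i)
    omega
  have heq : ν = fun i => t i := by
    funext i
    exact (Finset.sum_eq_sum_iff_of_le (fun i _ => hν i)).mp hsum i (Finset.mem_univ i)
  have := h0 ν hνZ
  rw [heq, expOf_coe] at this
  exact (mem_support_iff.mp ht) this

theorem kstat_le {n : ℕ} (ν : Fin n → ℕ) (i : Fin n) : kstat ν i ≤ 2 * n := by
  have h : ∀ s : Set (Fin n), s.ncard ≤ n := fun s => by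
    simpa using Set.ncard_le_card s
  unfold kstat
  have h1 := h {j : Fin n | j < i ∧ ν i < ν j}
  have h2 := h {j : Fin n | i < j ∧ ν i ≤ ν j}
  omega

/-- Matrix over `K` of the interpolation problem. -/
def matK (n d : ℕ) (Z : Set (Fin n → ℕ)) : Matrix (CompLe n d) (CompLe n d) K :=
  fun ν η => if ν.1 ∈ Z then (if ν = η then 1 else 0) else ∏ i, evalPt ν.1 i ^ η.1 i

/-- Rescaled matrix over the polynomial ring. -/
def matP (n d : ℕ) (Z : Set (Fin n → ℕ)) :
    Matrix (CompLe n d) (CompLe n d) (MvPolynomial (Fin 2) ℚ) :=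
  fun ν η => if ν.1 ∈ Z then (if ν = η then X 1 ^ (2 * n * csize η.1) else 0) else
    ∏ i, (X 0 ^ ν.1 i * X 1 ^ (2 * n - kstat ν.1 i)) ^ η.1 i

theorem tt_ne_zero : tt ≠ 0 := by
  unfold tt
  rw [Ne, IsFractionRing.to_map_eq_zero_iff]
  exact X_ne_zero 1

theorem matP_map (n d : ℕ) (Z : Set (Fin n → ℕ)) :
    (algebraMap (MvPolynomial (Fin 2) ℚ) K).mapMatrix (matP n d Z) =
      matK n d Z * Matrix.diagonal (fun η => tt ^ (2 * n * csize η.1)) := by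
  ext ν η
  rw [Matrix.mul_diagonal, RingHom.mapMatrix_apply, Matrix.map_apply]
  unfold matP matK
  by_cases h : ν.1 ∈ Z
  · rw [if_pos h, if_pos h]
    by_cases h' : ν = η
    · rw [if_pos h', if_pos h', map_pow, one_mul]; rfl
    · rw [if_neg h', if_neg h', map_zero, zero_mul]
  · rw [if_neg h, if_neg h, map_prod]
    have : tt ^ (2 * n * csize η.1) = ∏ i, (tt ^ (2 * n)) ^ η.1 i := by
      rw [Finset.prod_pow_eq_pow_sum, pow_mul]; rfl
    rw [this, ← Finset.prod_mul_distrib]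
    refine Finset.prod_congr rfl fun i _ => ?_
    rw [map_pow, ← mul_pow, map_mul, map_pow, map_pow]
    congr 1
    change qq ^ _ * tt ^ _ = _
    unfold evalPt
    rw [mul_assoc]
    congr 1
    rw [← zpow_natCast tt (2 * n), ← zpow_natCast tt, ← zpow_add₀ tt_ne_zero]
    congr 1
    have := kstat_le ν.1 i
    omega

theorem det_matP_ne_zero (n d : ℕ) (Z : Set (Fin n → ℕ)) (hZ : ∀ z ∈ Z, csize z = d) :
    (matP n d Z).det ≠ 0 := by
  intro h
  let φ : MvPolynomial (Fin 2) ℚ →+* ℚ := eval ![2, 1]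
  have h2 : (φ.mapMatrix (matP n d Z)).det = 0 := by rw [← RingHom.map_det, h, map_zero]
  obtain ⟨v, hv, hv0⟩ := Matrix.exists_mulVec_eq_zero_iff.mpr h2
  apply hv
  have hrow : ∀ ν : CompLe n d, ∑ η, φ (matP n d Z ν η) * v η = 0 := fun ν => congrFun hv0 ν
  have hp : polyOf v = 0 := by
    refine grid_unisolvent (d := d) (fun k => (2 : ℚ) ^ k)
      (pow_right_injective₀ (by norm_num) (by norm_num)) Z hZ _ (totalDegree_polyOf v) ?_ ?_
    · intro z hz
      have hzd : csize z ≤ d := (hZ z hz).le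
      have := hrow ⟨z, hzd⟩
      rw [coeff_polyOf v ⟨z, hzd⟩]
      rw [Finset.sum_eq_single ⟨z, hzd⟩] at this
      · simpa [matP, hz, φ] using this
      · intro b _ hb
        simp [matP, hz, hb.symm]
      · intro h; exact absurd (Finset.mem_univ _) h
    · intro ν hν hνZ
      have := hrow ⟨ν, hν⟩
      rw [eval_polyOf, ← this]
      refine Finset.sum_congr rfl fun η _ => ?_
      simp [matP, hνZ, φ]
  funext η
  rw [← coeff_polyOf v η, hp, coeff_zero]; rfl

theorem det_matK_ne_zero (n d : ℕ) (Z : Set (Fin n → ℕ)) (hZ : ∀ z ∈ Z, csize z = d) :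
    (matK n d Z).det ≠ 0 := by
  intro h
  have h1 := congrArg Matrix.det (matP_map n d Z)
  rw [← RingHom.map_det, Matrix.det_mul, h, zero_mul, IsFractionRing.to_map_eq_zero_iff] at h1
  exact det_matP_ne_zero n d Z hZ h1

theorem matK_mulVec (n d : ℕ) (Z : Set (Fin n → ℕ)) (c : CompLe n d → K) (ν : CompLe n d) :
    (matK n d Z).mulVec c ν =
      if ν.1 ∈ Z then coeff (expOf ν.1) (polyOf c) else eval (evalPt ν.1) (polyOf c) := by
  change ∑ η, matK n d Z ν η * c η = _
  by_cases h : ν.1 ∈ Z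
  · rw [if_pos h, coeff_polyOf]
    simp [matK, h]
  · rw [if_neg h, eval_polyOf]
    simp [matK, h]

/-- Uniqueness in the interpolation problem. -/
theorem interp_unique {n d : ℕ} (f : MvPolynomial (Fin n) K) (hf : f.totalDegree ≤ d)
    (h : ∀ ν : Fin n → ℕ, csize ν ≤ d → eval (evalPt ν) f = 0) : f = 0 := by
  by_contra hne
  refine det_matK_ne_zero n d ∅ (by simp) (Matrix.exists_mulVec_eq_zero_iff.mp
    ⟨fun η => coeff (expOf η.1) f, ?_, ?_⟩)
  · intro h0
    apply hne
    rw [← polyOf_coeff f hf, h0]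
    simp [polyOf]
  · funext ν
    rw [matK_mulVec, if_neg (Set.notMem_empty _), polyOf_coeff f hf]
    exact h ν.1 ν.2

theorem exists_isEstar {n : ℕ} (μ : Fin n → ℕ) : ∃ f, IsEstar μ f := by
  have hdet := det_matK_ne_zero n (csize μ) {μ} (by simp)
  have hsurj := (Matrix.mulVec_surjective_iff_isUnit
    (A := matK n (csize μ) {μ})).mpr
    ((Matrix.isUnit_iff_isUnit_det _).mpr hdet.isUnit)
  obtain ⟨c, hc⟩ := hsurj (fun ν => if ν.1 = μ then 1 else 0)
  have hc' : ∀ ν, _ := fun ν => congrFun hc ν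
  refine ⟨polyOf c, totalDegree_polyOf c, ?_, ?_⟩
  · have := hc' ⟨μ, le_rfl⟩
    rw [matK_mulVec] at this
    simpa using this
  · intro ν hν hne
    have := hc' ⟨ν, hν⟩
    rw [matK_mulVec] at this
    simpa [hne] using this

theorem isEstar_Estar {n : ℕ} (μ : Fin n → ℕ) : IsEstar μ (Estar μ) := by
  unfold Estar
  rw [dif_pos (exists_isEstar μ)]
  exact (exists_isEstar μ).choose_spec

theorem eval_Estar_ne_zero {n : ℕ} (μ : Fin n → ℕ) : eval (evalPt μ) (Estar μ) ≠ 0 := by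
  intro h
  obtain ⟨h1, h2, h3⟩ := isEstar_Estar μ
  have : Estar μ = 0 := by
    refine interp_unique (d := csize μ) _ h1 fun ν hν => ?_
    by_cases hνμ : ν = μ
    · rw [hνμ, h]
    · exact h3 ν hν hνμ
  rw [this, coeff_zero] at h2
  exact zero_ne_one h2

theorem csize_of_mem_Sn {n : ℕ} {l μ : Fin n → ℕ} (h : μ ∈ Sn l) : csize μ = csize l := by
  obtain ⟨σ, rfl⟩ := h
  exact Equiv.sum_comp σ.symm l

theorem mem_SnFinset {n : ℕ} {l μ : Fin n → ℕ} : μ ∈ SnFinset l ↔ μ ∈ Sn l := by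
  simp [SnFinset, Sn]

theorem mem_Vstar {n : ℕ} {l : Fin n → ℕ} {f : MvPolynomial (Fin n) K} :
    f ∈ Vstar l ↔ f.totalDegree ≤ csize l ∧
      ∀ ν : Fin n → ℕ, csize ν ≤ csize l → ν ∉ Sn l → eval (evalPt ν) f = 0 := by
  unfold Vstar
  rw [Submodule.mem_inf, mem_restrictTotalDegree]
  refine and_congr_right fun _ => ?_
  simp only [Submodule.mem_iInf, LinearMap.mem_ker, AlgHom.toLinearMap_apply, and_imp,
    coe_aeval_eq_eval, aeval_eq_eval]

/-- `V*_λ = span {E*_μ : μ ∈ S_n(λ)}`. -/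
theorem statement3 (n : ℕ) (hn : 1 ≤ n) (l : Fin n → ℕ) (hl : IsPartition l) :
    Vstar l = Submodule.span K ((fun μ : Fin n → ℕ => Estar μ) '' Sn l) := by
  have hEV : ∀ μ ∈ Sn l, Estar μ ∈ Vstar l := by
    intro μ hμ
    obtain ⟨h1, h2, h3⟩ := isEstar_Estar μ
    have hs := csize_of_mem_Sn hμ
    rw [mem_Vstar]
    refine ⟨hs ▸ h1, fun ν hν hνl => h3 ν (hs ▸ hν) ?_⟩
    rintro rfl
    exact hνl hμ
  apply le_antisymm
  · intro f hf
    let g : MvPolynomial (Fin n) K :=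
      ∑ μ ∈ SnFinset l, (eval (evalPt μ) f / eval (evalPt μ) (Estar μ)) • Estar μ
    have hgV : g ∈ Vstar l := Submodule.sum_mem _ fun μ hμ =>
      Submodule.smul_mem _ _ (hEV μ (mem_SnFinset.mp hμ))
    have hgs : g ∈ Submodule.span K ((fun μ : Fin n → ℕ => Estar μ) '' Sn l) :=
      Submodule.sum_mem _ fun μ hμ => Submodule.smul_mem _ _
        (Submodule.subset_span ⟨μ, mem_SnFinset.mp hμ, rfl⟩)
    have hd := mem_Vstar.mp (Submodule.sub_mem _ hf hgV)
    have : f - g = 0 := by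
      refine interp_unique (d := csize l) _ hd.1 fun ν hν => ?_
      by_cases hνl : ν ∈ Sn l
      · rw [map_sub, sub_eq_zero]
        change _ = eval _ (∑ μ ∈ SnFinset l, _)
        rw [map_sum, Finset.sum_eq_single ν]
        · rw [smul_eval, div_mul_cancel₀ _ (eval_Estar_ne_zero ν)]
        · intro μ hμ hne
          rw [smul_eval, (isEstar_Estar μ).2.2 ν
            (hν.trans (csize_of_mem_Sn (mem_SnFinset.mp hμ)).ge) hne.symm, mul_zero]
        · intro h; exact absurd (mem_SnFinset.mpr hνl) h
      · exact hd.2 ν hν hνl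
    rw [sub_eq_zero.mp this]
    exact hgs
  · rw [Submodule.span_le]
    rintro _ ⟨μ, hμ, rfl⟩
    exact hEV μ hμ
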